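/- Let φ be a 3-CNF formula in which every clause has exactly three literals whose variables are pairwise distinct and every variable occurs in at least two clauses, and let G_φ and k_φ = 14|C(φ)| be as defined in the context. Then φ is satisfiable if and only if there exists a set S of non-edges of G_φ with |S| ≤ k_φ such that G_φ + S contains no induced cycle on four vertices (no induced C4). -/

import Mathlib

open SimpleGraph

variable {Var : Type} [DecidableEq Var]

/-- `p_x`: the number of clauses containing the variable `x`.  Clauses are indexed by
`Fin m` and `lit c a` is the `a`-th literal of clause `c` (a variable with a Boolean which
is `true` for a non-negated occurrence). -/
def numOcc {m : ℕ} (lit : Fin m → Fin 3 → Var × Bool) (x : Var) : ℕ :=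
  (Finset.univ.filter (fun c : Fin m => ∃ a : Fin 3, (lit c a).1 = x)).card

/-- The (0-based) occurrence index of clause `c` among the clauses containing `x`:
the number of clauses before `c` that contain `x`. -/
def occIdx {m : ℕ} (lit : Fin m → Fin 3 → Var × Bool) (x : Var) (c : Fin m) : ℕ :=
  (Finset.univ.filter (fun c' : Fin m => c' < c ∧ ∃ a : Fin 3, (lit c' a).1 = x)).card

/-- The graph `G_φ` of the reduction from 3-SAT to `C₄`-free completion.
Variable gadget for `x`: vertices `(i, r)` with `i : Fin (4 p_x)` and `r : Fin 4`
(`r = 0,1,2,3` encoding `u^x_i, t^x_i, b^x_i, d^x_i`).  Clause gadget for `c`: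
core vertices `Fin 8` (`0,1,2,3` are `v^c_1,…,v^c_4` and `4,5,6,7` are `u^c_1,…,u^c_4`)
together with vertices `(q, e) : Fin (14 m) × Fin 2` (`a_q` and `b_q`, the inner vertices of
the `q`-th path `v^c_4 - a_q - b_q - u^c_4`). -/
def satC4ComplGraph {m : ℕ} (lit : Fin m → Fin 3 → Var × Bool) :
    SimpleGraph ((Σ x : Var, Fin (4 * numOcc lit x) × Fin 4) ⊕
      (Fin m × (Fin 8 ⊕ Fin (14 * m) × Fin 2))) :=
  SimpleGraph.fromRel (fun uu ww =>
    match uu, ww with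
    | Sum.inl ⟨x, (i, r)⟩, Sum.inl ⟨y, (j, r')⟩ =>
        x = y ∧
        ( ((j : ℕ) = (i : ℕ) ∧
            (((r : ℕ) = 0 ∧ (r' : ℕ) = 1) ∨ ((r : ℕ) = 1 ∧ (r' : ℕ) = 2) ∨
             ((r : ℕ) = 2 ∧ (r' : ℕ) = 3))) ∨
          ((j : ℕ) = ((i : ℕ) + 1) % (4 * numOcc lit x) ∧
            (((r : ℕ) = 0 ∧ (r' : ℕ) = 1) ∨ ((r : ℕ) = 1 ∧ (r' : ℕ) = 0) ∨
             ((r : ℕ) = 1 ∧ (r' : ℕ) = 1) ∨ ((r : ℕ) = 2 ∧ (r' : ℕ) = 2) ∨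
             ((r : ℕ) = 2 ∧ (r' : ℕ) = 3) ∨ ((r : ℕ) = 3 ∧ (r' : ℕ) = 2))))
    | Sum.inl ⟨x, (i, r)⟩, Sum.inr (c, Sum.inl s) =>
        (∃ a : Fin 3, lit c a = (x, true) ∧
          (((r : ℕ) = 1 ∧ (i : ℕ) = 4 * occIdx lit x c + 1 ∧ (s : ℕ) = (a : ℕ)) ∨
           ((r : ℕ) = 2 ∧ (i : ℕ) = 4 * occIdx lit x c ∧ (s : ℕ) = (a : ℕ) + 4))) ∨
        (∃ a : Fin 3, lit c a = (x, false) ∧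
          (((r : ℕ) = 1 ∧ (i : ℕ) = 4 * occIdx lit x c ∧ (s : ℕ) = (a : ℕ)) ∨
           ((r : ℕ) = 2 ∧ (i : ℕ) = 4 * occIdx lit x c + 1 ∧ (s : ℕ) = (a : ℕ) + 4)))
    | Sum.inl _, Sum.inr (_, Sum.inr _) => False
    | Sum.inr (c, z), Sum.inr (d, z') =>
        c = d ∧
        (match z, z' with
         | Sum.inl s, Sum.inl s' =>
             (((s : ℕ), (s' : ℕ)) ∈
               ({(0, 3), (3, 1), (1, 2), (2, 0), (1, 4), (4, 5), (5, 0), (2, 7), (7, 6),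
                 (6, 3)} : Set (ℕ × ℕ)))
         | Sum.inl s, Sum.inr (_, e) =>
             ((s : ℕ) = 3 ∧ (e : ℕ) = 0) ∨ ((s : ℕ) = 7 ∧ (e : ℕ) = 1)
         | Sum.inr _, Sum.inl _ => False
         | Sum.inr (q, e), Sum.inr (q', e') => q = q' ∧ (e : ℕ) = 0 ∧ (e' : ℕ) = 1)
    | Sum.inr _, Sum.inl _ => False)

/-- A graph has no induced `C₄` iff every 4-cycle has a chord. -/
theorem isEmpty_cycleGraph_four_embedding_iff {V : Type*} (H : SimpleGraph V) :
    IsEmpty (SimpleGraph.cycleGraph 4 ↪g H) ↔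
      ∀ a b c d, H.Adj a b → H.Adj b c → H.Adj c d → H.Adj d a → a ≠ c → b ≠ d →
        H.Adj a c ∨ H.Adj b d := by
  constructor
  · intro h a b c d hab hbc hcd hda hac hbd
    by_contra! hn
    refine h.false ⟨⟨![a, b, c, d], ?_⟩, ?_⟩
    · intro i j hij
      fin_cases i <;> fin_cases j <;>
        simp_all [hab.ne, hbc.ne, hcd.ne, hda.ne, hab.ne', hbc.ne', hcd.ne', hda.ne', eq_comm]
    · intro i j
      change H.Adj (![a, b, c, d] i) (![a, b, c, d] j) ↔ _
      have hn₁ : ¬ H.Adj c a := fun h => hn.1 h.symm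
      have hn₂ : ¬ H.Adj d b := fun h => hn.2 h.symm
      have hC : (SimpleGraph.cycleGraph 4).Adj i j ↔
          (i, j) ∈ [((0 : Fin 4), (1 : Fin 4)), (1, 2), (2, 3), (3, 0), (1, 0), (2, 1), (3, 2),
            (0, 3)] := by
        revert i j; decide
      rw [hC]
      fin_cases i <;> fin_cases j <;>
        simp [hab, hbc, hcd, hda, hab.symm, hbc.symm, hcd.symm, hda.symm, hn.1, hn.2, hn₁, hn₂]
  · refine fun h => ⟨fun f => ?_⟩
    have key : ∀ i j, H.Adj (f i) (f j) ↔ (SimpleGraph.cycleGraph 4).Adj i j :=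
      fun i j => f.map_adj_iff
    have := h (f 0) (f 1) (f 2) (f 3)
    simp only [key, ne_eq, EmbeddingLike.apply_eq_iff_eq] at this
    revert this
    decide

/-- Label pairs joined inside one rung of a variable gadget. -/
def rungPairs : List (Fin 4 × Fin 4) := [(0, 1), (1, 2), (2, 3)]

/-- Label pairs joined from a rung to the next one.  The optional Boolean is the orientation
of the diagonals added to the squares (`true` for `t_i b_{i+1}`, `false` for `t_{i+1} b_i`). -/
def stepPairs : Option Bool → List (Fin 4 × Fin 4)
  | none => [(0, 1), (1, 0), (1, 1), (2, 2), (2, 3), (3, 2)]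
  | some true => [(0, 1), (1, 0), (1, 1), (2, 2), (2, 3), (3, 2), (1, 2)]
  | some false => [(0, 1), (1, 0), (1, 1), (2, 2), (2, 3), (3, 2), (2, 1)]

/-- Adjacency in a variable gadget, in terms of the index difference `δ`. -/
def LadderAdj (o : Option Bool) (δ : ℤ) (r r' : Fin 4) : Prop :=
  (δ = 0 ∧ ((r, r') ∈ rungPairs ∨ (r', r) ∈ rungPairs)) ∨
    (δ = 1 ∧ (r, r') ∈ stepPairs o) ∨ (δ = -1 ∧ (r', r) ∈ stepPairs o)

instance (o : Option Bool) (δ : ℤ) (r r' : Fin 4) : Decidable (LadderAdj o δ r r') := by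
  unfold LadderAdj; infer_instance

/-- The core edges of a clause gadget, with the two edges added for the chosen literal. -/
def corePairs : Option (Fin 3) → List (Fin 8 × Fin 8)
  | none => [(0, 3), (3, 1), (1, 2), (2, 0), (1, 4), (4, 5), (5, 0), (2, 7), (7, 6), (6, 3)]
  | some a => (match a with
      | 0 => [(0, 1), (0, 4)]
      | 1 => [(0, 1), (1, 5)]
      | 2 => [(2, 3), (2, 6)]) ++
    [(0, 3), (3, 1), (1, 2), (2, 0), (1, 4), (4, 5), (5, 0), (2, 7), (7, 6), (6, 3)]

/-- Adjacency in the core of a clause gadget. -/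
def CoreAdj (o : Option (Fin 3)) (s s' : Fin 8) : Prop :=
  (s, s') ∈ corePairs o ∨ (s', s) ∈ corePairs o

instance (o : Option (Fin 3)) (s s' : Fin 8) : Decidable (CoreAdj o s s') := by
  unfold CoreAdj; infer_instance

set_option maxRecDepth 10000 in
theorem CoreAdj.exists_chord : ∀ (a : Fin 3) (s₀ s₁ : Fin 8), CoreAdj (some a) s₀ s₁ →
    ∀ s₂, CoreAdj (some a) s₁ s₂ → s₀ ≠ s₂ → ∀ s₃, CoreAdj (some a) s₂ s₃ →
      CoreAdj (some a) s₃ s₀ → s₁ ≠ s₃ →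
      CoreAdj (some a) s₀ s₂ ∨ CoreAdj (some a) s₁ s₃ := by
  decide +kernel

theorem LadderAdj.abs_le {o : Option Bool} {δ : ℤ} {r r' : Fin 4} (h : LadderAdj o δ r r') :
    -1 ≤ δ ∧ δ ≤ 1 := by
  unfold LadderAdj at h; omega

set_option maxRecDepth 10000 in
theorem LadderAdj.exists_chord_of_mem : ∀ (o : Bool) (r₀ r₁ : Fin 4),
    ∀ δ₁ ∈ [(-1 : ℤ), 0, 1], LadderAdj (some o) δ₁ r₀ r₁ →
    ∀ (r₂ : Fin 4), ∀ δ₂ ∈ [(-1 : ℤ), 0, 1], LadderAdj (some o) δ₂ r₁ r₂ →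
    ∀ (r₃ : Fin 4), ∀ δ₃ ∈ [(-1 : ℤ), 0, 1], LadderAdj (some o) δ₃ r₂ r₃ →
    LadderAdj (some o) (-(δ₁ + δ₂ + δ₃)) r₃ r₀ →
      (LadderAdj (some o) (δ₁ + δ₂) r₀ r₂ ∨ (δ₁ + δ₂ = 0 ∧ r₀ = r₂)) ∨
      (LadderAdj (some o) (δ₂ + δ₃) r₁ r₃ ∨ (δ₂ + δ₃ = 0 ∧ r₁ = r₃)) := by
  decide +kernel

theorem LadderAdj.exists_chord {o : Bool} {r₀ r₁ r₂ r₃ : Fin 4} {δ₁ δ₂ δ₃ δ₄ : ℤ}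
    (h₁ : LadderAdj (some o) δ₁ r₀ r₁) (h₂ : LadderAdj (some o) δ₂ r₁ r₂)
    (h₃ : LadderAdj (some o) δ₃ r₂ r₃) (h₄ : LadderAdj (some o) δ₄ r₃ r₀)
    (hsum : δ₁ + δ₂ + δ₃ + δ₄ = 0) :
      (LadderAdj (some o) (δ₁ + δ₂) r₀ r₂ ∨ (δ₁ + δ₂ = 0 ∧ r₀ = r₂)) ∨
      (LadderAdj (some o) (δ₂ + δ₃) r₁ r₃ ∨ (δ₂ + δ₃ = 0 ∧ r₁ = r₃)) := by
  have mem : ∀ {δ : ℤ} {r r' : Fin 4}, LadderAdj (some o) δ r r' → δ ∈ [(-1 : ℤ), 0, 1] := by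
    intro δ r r' h
    have := h.abs_le
    simp only [List.mem_cons, List.not_mem_nil, or_false]
    omega
  obtain rfl : δ₄ = -(δ₁ + δ₂ + δ₃) := by omega
  exact LadderAdj.exists_chord_of_mem o r₀ r₁ δ₁ (mem h₁) h₁ r₂ δ₂ (mem h₂) h₂ r₃ δ₃ (mem h₃) h₃ h₄

theorem int_dvd_sub_iff {n i j : ℕ} (hi : i < n) (hj : j < n) :
    (n : ℤ) ∣ (j : ℤ) - i ↔ j = i := by
  constructor
  · intro h
    have := Int.eq_zero_of_abs_lt_dvd h (by rw [abs_lt]; omega)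
    omega
  · rintro rfl; simp

theorem int_dvd_sub_sub_one_iff {n i j : ℕ} (hj : j < n) :
    (n : ℤ) ∣ (j : ℤ) - i - 1 ↔ j = (i + 1) % n := by
  rw [← int_dvd_sub_iff (Nat.mod_lt _ (by omega)) hj, Int.natCast_mod, Int.dvd_iff_emod_eq_zero,
    Int.dvd_iff_emod_eq_zero, Int.sub_emod_emod]
  push_cast
  rw [sub_sub]

theorem occIdx_lt_numOcc {m : ℕ} (lit : Fin m → Fin 3 → Var × Bool) (c : Fin m) (a : Fin 3) :
    occIdx lit (lit c a).1 c < numOcc lit (lit c a).1 := by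
  refine Finset.card_lt_card (Finset.ssubset_iff.2 ⟨c, by simp, ?_⟩)
  intro d hd
  simp only [Finset.mem_insert, Finset.mem_filter, Finset.mem_univ, true_and] at hd ⊢
  rcases hd with rfl | hd
  exacts [⟨a, rfl⟩, hd.2]

theorem occIdx_lt_occIdx {m : ℕ} (lit : Fin m → Fin 3 → Var × Bool) {x : Var} {c d : Fin m}
    (hcd : c < d) (hc : ∃ a, (lit c a).1 = x) : occIdx lit x c < occIdx lit x d := by
  refine Finset.card_lt_card (Finset.ssubset_iff.2 ⟨c, by simp, ?_⟩)
  intro e he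
  simp only [Finset.mem_insert, Finset.mem_filter, Finset.mem_univ, true_and] at he ⊢
  rcases he with rfl | he
  exacts [⟨hcd, hc⟩, ⟨he.1.trans hcd, he.2⟩]

theorem occIdx_injective {m : ℕ} (lit : Fin m → Fin 3 → Var × Bool) {x : Var} {c d : Fin m}
    (hc : ∃ a, (lit c a).1 = x) (hd : ∃ a, (lit d a).1 = x)
    (h : occIdx lit x c = occIdx lit x d) : c = d := by
  rcases lt_trichotomy c d with hlt | rfl | hlt
  · exact absurd h (occIdx_lt_occIdx lit hlt hc).ne
  · rfl
  · exact absurd h (occIdx_lt_occIdx lit hlt hd).ne'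

/-- The vertices of `satC4ComplGraph lit`. -/
abbrev GadgetVertex {m : ℕ} (lit : Fin m → Fin 3 → Var × Bool) : Type :=
  (Σ x : Var, Fin (4 * numOcc lit x) × Fin 4) ⊕ (Fin m × (Fin 8 ⊕ Fin (14 * m) × Fin 2))

/-- The attachment of the rung vertex `(x, i, r)` to the core vertex `s` of the clause `c`. -/
def CrossAdj {m : ℕ} (lit : Fin m → Fin 3 → Var × Bool) (x : Var) (i : ℕ) (r : Fin 4)
    (c : Fin m) (s : Fin 8) : Prop :=
  ∃ a : Fin 3, (lit c a).1 = x ∧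
    ((r = 1 ∧ i = 4 * occIdx lit x c + (lit c a).2.toNat ∧ (s : ℕ) = a) ∨
     (r = 2 ∧ i = 4 * occIdx lit x c + (!(lit c a).2).toNat ∧ (s : ℕ) = a + 4))

section Adjacency

variable {m : ℕ} (lit : Fin m → Fin 3 → Var × Bool)

theorem satC4ComplGraph_adj_inl_inl (hocc : ∀ x : Var, 2 ≤ numOcc lit x) (x y : Var)
    (i : Fin (4 * numOcc lit x)) (j : Fin (4 * numOcc lit y)) (r r' : Fin 4) :
    (satC4ComplGraph lit).Adj (Sum.inl ⟨x, i, r⟩) (Sum.inl ⟨y, j, r'⟩) ↔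
      x = y ∧ ∃ δ : ℤ, LadderAdj none δ r r' ∧
        ((4 * numOcc lit x : ℕ) : ℤ) ∣ (j : ℤ) - (i : ℤ) - δ := by
  by_cases hxy : x = y
  · subst hxy
    have hn := hocc x
    have e0 := int_dvd_sub_iff i.2 j.2
    have e1 := int_dvd_sub_sub_one_iff (i := i) j.2
    have e2 := int_dvd_sub_sub_one_iff (i := j) i.2
    have e3 : ((4 * numOcc lit x : ℕ) : ℤ) ∣ (j : ℤ) - (i : ℤ) - (-1) ↔
        ((4 * numOcc lit x : ℕ) : ℤ) ∣ (i : ℤ) - (j : ℤ) - 1 := by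
      rw [← dvd_neg]; congr! 1; ring
    have hR : (∃ δ : ℤ, LadderAdj none δ r r' ∧
        ((4 * numOcc lit x : ℕ) : ℤ) ∣ (j : ℤ) - (i : ℤ) - δ) ↔
        (((r, r') ∈ rungPairs ∨ (r', r) ∈ rungPairs) ∧ (j : ℕ) = i) ∨
        ((r, r') ∈ stepPairs none ∧ (j : ℕ) = (i + 1) % (4 * numOcc lit x)) ∨
        ((r', r) ∈ stepPairs none ∧ (i : ℕ) = (j + 1) % (4 * numOcc lit x)) := by
      rw [← e0, ← e1, ← e2, ← e3]
      constructor
      · rintro ⟨δ, ⟨rfl, h⟩ | ⟨rfl, h⟩ | ⟨rfl, h⟩, hd⟩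
        · exact Or.inl ⟨h, by simpa using hd⟩
        · exact Or.inr (Or.inl ⟨h, hd⟩)
        · exact Or.inr (Or.inr ⟨h, hd⟩)
      · rintro (⟨h, hd⟩ | ⟨h, hd⟩ | ⟨h, hd⟩)
        · exact ⟨0, Or.inl ⟨rfl, h⟩, by simpa using hd⟩
        · exact ⟨1, Or.inr (Or.inl ⟨rfl, h⟩), hd⟩
        · exact ⟨-1, Or.inr (Or.inr ⟨rfl, h⟩), hd⟩
    rw [hR]
    have hne : (i : ℕ) ≠ (i + 1) % (4 * numOcc lit x) := by
      intro h
      have := (int_dvd_sub_sub_one_iff (i := i) i.2).2 h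
      have := Int.eq_zero_of_abs_lt_dvd this (by rw [abs_lt]; omega)
      omega
    have hne' : i = j → (j : ℕ) ≠ (i + 1) % (4 * numOcc lit x) ∧
        (i : ℕ) ≠ (j + 1) % (4 * numOcc lit x) := by
      rintro rfl; exact ⟨hne, hne⟩
    simp only [satC4ComplGraph, SimpleGraph.fromRel_adj, ne_eq, Sum.inl.injEq, Sigma.mk.injEq,
      heq_eq_eq, true_and, Prod.mk.injEq, Fin.ext_iff] at hne' ⊢
    generalize (i + 1 : ℕ) % (4 * numOcc lit x) = i' at *
    generalize (j + 1 : ℕ) % (4 * numOcc lit x) = j' at *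
    simp only [rungPairs, stepPairs, List.mem_cons, List.not_mem_nil, or_false, Prod.mk.injEq,
      Fin.ext_iff]
    clear hR e0 e1 e2 e3
    simp only [Fin.coe_ofNat_eq_mod, Nat.reduceMod]
    generalize (i : ℕ) = a at *
    generalize (j : ℕ) = b at *
    generalize (r : ℕ) = r at *
    generalize (r' : ℕ) = r' at *
    grind
  · have : y ≠ x := Ne.symm hxy
    simp [satC4ComplGraph, hxy, this]

theorem satC4ComplGraph_adj_inl_core (x : Var) (i : Fin (4 * numOcc lit x)) (r : Fin 4)
    (c : Fin m) (s : Fin 8) :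
    (satC4ComplGraph lit).Adj (Sum.inl ⟨x, i, r⟩) (Sum.inr (c, Sum.inl s)) ↔
      CrossAdj lit x i r c s := by
  simp only [satC4ComplGraph, SimpleGraph.fromRel_adj, ne_eq, reduceCtorEq, not_false_eq_true,
    true_and, or_false, CrossAdj, ← exists_or]
  refine exists_congr fun a => ?_
  have h1 : (r : ℕ) = 1 ↔ r = 1 := by rw [Fin.ext_iff]; rfl
  have h2 : (r : ℕ) = 2 ↔ r = 2 := by rw [Fin.ext_iff]; rfl
  rw [h1, h2]
  rcases h : lit c a with ⟨y, b⟩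
  cases b <;> simp

theorem satC4ComplGraph_not_adj_inl_path (w : Σ x : Var, Fin (4 * numOcc lit x) × Fin 4)
    (c : Fin m) (p : Fin (14 * m) × Fin 2) :
    ¬ (satC4ComplGraph lit).Adj (Sum.inl w) (Sum.inr (c, Sum.inr p)) := by
  simp [satC4ComplGraph]

theorem satC4ComplGraph_adj_core_core (c d : Fin m) (s s' : Fin 8) :
    (satC4ComplGraph lit).Adj (Sum.inr (c, Sum.inl s)) (Sum.inr (d, Sum.inl s')) ↔
      c = d ∧ CoreAdj none s s' := by
  have key : ∀ s s' : Fin 8, (((s : ℕ), (s' : ℕ)) ∈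
               ({(0, 3), (3, 1), (1, 2), (2, 0), (1, 4), (4, 5), (5, 0), (2, 7), (7, 6),
                 (6, 3)} : Set (ℕ × ℕ))) ↔ (s, s') ∈ corePairs none := by
    intro s s'
    simp only [corePairs, Set.mem_insert_iff, Set.mem_singleton_iff, Prod.mk.injEq,
      List.mem_cons, List.not_mem_nil, or_false, Fin.ext_iff, Fin.coe_ofNat_eq_mod, Nat.reduceMod]
  have irr : ∀ s : Fin 8, (s, s) ∉ corePairs none := by decide
  simp only [satC4ComplGraph, SimpleGraph.fromRel_adj, key, CoreAdj, ne_eq, Sum.inr.injEq,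
    Prod.mk.injEq, Sum.inl.injEq]
  grind

theorem satC4ComplGraph_adj_core_path (c d : Fin m) (s : Fin 8) (q : Fin (14 * m)) (e : Fin 2) :
    (satC4ComplGraph lit).Adj (Sum.inr (c, Sum.inl s)) (Sum.inr (d, Sum.inr (q, e))) ↔
      c = d ∧ ((s = 3 ∧ e = 0) ∨ (s = 7 ∧ e = 1)) := by
  simp only [satC4ComplGraph, SimpleGraph.fromRel_adj, ne_eq, Sum.inr.injEq,
    Prod.mk.injEq, Fin.ext_iff, reduceCtorEq, and_false, not_false_eq_true, true_and, or_false]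
  rfl

theorem satC4ComplGraph_adj_path_path (c d : Fin m) (q q' : Fin (14 * m)) (e e' : Fin 2) :
    (satC4ComplGraph lit).Adj (Sum.inr (c, Sum.inr (q, e))) (Sum.inr (d, Sum.inr (q', e'))) ↔
      c = d ∧ q = q' ∧ e ≠ e' := by
  simp only [satC4ComplGraph, SimpleGraph.fromRel_adj, ne_eq, Sum.inr.injEq,
    Prod.mk.injEq, Fin.ext_iff]
  have := e.2
  have := e'.2
  omega

end Adjacency

/-- The cyclic successor of a rung index. -/
def nextRung {n : ℕ} (i : Fin n) : Fin n :=
  ⟨(i + 1) % n, Nat.mod_lt _ (i.pos)⟩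

theorem eq_nextRung_iff {n : ℕ} {i j : Fin n} :
    j = nextRung i ↔ (n : ℤ) ∣ (j : ℤ) - i - 1 := by
  rw [int_dvd_sub_sub_one_iff j.2, Fin.ext_iff, nextRung]

theorem eq_nextRung_iff' {n : ℕ} {i j : Fin n} :
    j = nextRung i ↔ (n : ℤ) ∣ (i : ℤ) - j - (-1) := by
  rw [eq_nextRung_iff, ← dvd_neg]; congr! 1; ring

section Completion

variable {m : ℕ} (lit : Fin m → Fin 3 → Var × Bool)

/-- Index type of the edges of the completion: one per square of a variable gadget and two per
clause. -/
abbrev AddedIndex : Type := (Σ x : Var, Fin (4 * numOcc lit x)) ⊕ (Fin m × Fin 2)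

/-- The core vertices `v^c_{a+1}` of a clause gadget. -/
def clauseV (a : Fin 3) : Fin 8 := ⟨a, by omega⟩

/-- The core vertices `u^c_{a+1}` of a clause gadget. -/
def clauseU (a : Fin 3) : Fin 8 := ⟨a + 4, by omega⟩

/-- One diagonal for each square of a variable gadget, oriented by `o`, and two edges for each
clause `c`, chosen by the position `σ c` of one of its literals. -/
def addedEdge (o : ∀ x, Fin (4 * numOcc lit x) → Bool) (σ : Fin m → Fin 3) :
    AddedIndex lit → Sym2 (GadgetVertex lit)
  | Sum.inl ⟨x, i⟩ =>
      if o x i then s(Sum.inl ⟨x, i, 1⟩, Sum.inl ⟨x, nextRung i, 2⟩)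
      else s(Sum.inl ⟨x, nextRung i, 1⟩, Sum.inl ⟨x, i, 2⟩)
  | Sum.inr (c, e) =>
      if e = 0 then
        if σ c = 2 then s(Sum.inr (c, Sum.inl 2), Sum.inr (c, Sum.inl 3))
        else s(Sum.inr (c, Sum.inl 0), Sum.inr (c, Sum.inl 1))
      else s(Sum.inr (c, Sum.inl (clauseV (σ c))), Sum.inr (c, Sum.inl (clauseU (σ c))))

/-- The diagonals of the squares with orientation `o`, by index difference and labels. -/
def DiagonalAdj (o : Bool) (δ : ℤ) (r r' : Fin 4) : Prop :=
  (δ = (if o then 1 else -1) ∧ r = 1 ∧ r' = 2) ∨ (δ = (if o then -1 else 1) ∧ r = 2 ∧ r' = 1)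

theorem ladderAdj_some_iff {o : Bool} {δ : ℤ} {r r' : Fin 4} :
    LadderAdj (some o) δ r r' ↔ LadderAdj none δ r r' ∨ DiagonalAdj o δ r r' := by
  cases o <;> simp only [LadderAdj, DiagonalAdj, stepPairs, List.mem_cons, Prod.mk.injEq,
    List.not_mem_nil, or_false] <;> grind

variable (o : ∀ x, Fin (4 * numOcc lit x) → Bool) (α : Var → Bool) (σ : Fin m → Fin 3)

theorem inl_inl_mem_range_addedEdge (x y : Var) (i : Fin (4 * numOcc lit x))
    (j : Fin (4 * numOcc lit y)) (r r' : Fin 4) :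
    s(Sum.inl ⟨x, i, r⟩, Sum.inl ⟨y, j, r'⟩) ∈ Set.range (addedEdge lit (fun x _ => α x) σ) ↔
      x = y ∧ ∃ δ : ℤ, DiagonalAdj (α x) δ r r' ∧
        ((4 * numOcc lit x : ℕ) : ℤ) ∣ (j : ℤ) - (i : ℤ) - δ := by
  constructor
  · rintro ⟨⟨z, k⟩ | ⟨d, f⟩, h⟩
    · simp only [addedEdge] at h
      split_ifs at h with hz <;>
        simp only [Sym2.eq_iff, Sum.inl.injEq, Sigma.mk.injEq] at h <;>
        rcases h with ⟨⟨rfl, h1⟩, ⟨rfl, h2⟩⟩ | ⟨⟨rfl, h1⟩, ⟨rfl, h2⟩⟩ <;>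
        simp only [heq_eq_eq, Prod.mk.injEq] at h1 h2 <;>
        obtain ⟨rfl, rfl⟩ := h1 <;> obtain ⟨rfl, rfl⟩ := h2 <;>
        refine ⟨rfl, ?_⟩
      · exact ⟨1, by simp [DiagonalAdj, hz], eq_nextRung_iff.1 rfl⟩
      · exact ⟨-1, by simp [DiagonalAdj, hz], eq_nextRung_iff'.1 rfl⟩
      · exact ⟨-1, by simp [DiagonalAdj, hz], eq_nextRung_iff'.1 rfl⟩
      · exact ⟨1, by simp [DiagonalAdj, hz], eq_nextRung_iff.1 rfl⟩
    · simp only [addedEdge] at h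
      split_ifs at h <;> simp at h
  · rintro ⟨rfl, δ, ⟨rfl, rfl, rfl⟩ | ⟨rfl, rfl, rfl⟩, hd⟩ <;> split_ifs at hd with hz
    · rw [← eq_nextRung_iff] at hd
      exact ⟨Sum.inl ⟨x, i⟩, by simp [addedEdge, hz, hd]⟩
    · rw [← eq_nextRung_iff'] at hd
      exact ⟨Sum.inl ⟨x, j⟩, by simp [addedEdge, hz, hd]⟩
    · rw [← eq_nextRung_iff'] at hd
      exact ⟨Sum.inl ⟨x, j⟩, by simp [addedEdge, hz, hd]⟩
    · rw [← eq_nextRung_iff] at hd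
      exact ⟨Sum.inl ⟨x, i⟩, by simp [addedEdge, hz, hd]⟩

theorem inl_inr_notMem_range_addedEdge (w : Σ x : Var, Fin (4 * numOcc lit x) × Fin 4)
    (z : Fin m × (Fin 8 ⊕ Fin (14 * m) × Fin 2)) :
    s(Sum.inl w, Sum.inr z) ∉ Set.range (addedEdge lit o σ) := by
  rintro ⟨⟨y, k⟩ | ⟨d, f⟩, h⟩ <;> simp only [addedEdge] at h <;> split_ifs at h <;> simp at h

theorem path_notMem_range_addedEdge (c : Fin m) (p : Fin (14 * m) × Fin 2)
    (w : GadgetVertex lit) :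
    s(w, Sum.inr (c, Sum.inr p)) ∉ Set.range (addedEdge lit o σ) := by
  rintro ⟨⟨y, k⟩ | ⟨d, f⟩, h⟩ <;> simp only [addedEdge] at h <;> split_ifs at h <;> simp at h

theorem core_core_mem_range_addedEdge (c d : Fin m) (s s' : Fin 8) :
    s(Sum.inr (c, Sum.inl s), Sum.inr (d, Sum.inl s')) ∈ Set.range (addedEdge lit o σ) ↔
      c = d ∧ s(s, s') ∈ ({s(clauseV (σ c), clauseU (σ c)),
        if σ c = 2 then s(2, 3) else s(0, 1)} : Set (Sym2 (Fin 8))) := by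
  constructor
  · rintro ⟨⟨y, k⟩ | ⟨d, f⟩, h⟩ <;> simp only [addedEdge] at h <;> split_ifs at h <;>
      simp at h <;> grind
  · rintro ⟨rfl, h | h⟩
    · refine ⟨Sum.inr (c, 1), ?_⟩
      simp only [addedEdge]
      simp at h ⊢
      grind
    · refine ⟨Sum.inr (c, 0), ?_⟩
      simp only [addedEdge]
      split_ifs at h ⊢ <;> simp at h ⊢ <;> grind

theorem coreAdj_some_iff : ∀ {a : Fin 3} {s s' : Fin 8}, CoreAdj (some a) s s' ↔
    CoreAdj none s s' ∨ (s(s, s') = s(clauseV a, clauseU a) ∨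
      s(s, s') = if a = 2 then s(2, 3) else s(0, 1)) := by
  decide

/-- The completion of `satC4ComplGraph lit` given by `α` and `σ`. -/
def completion : SimpleGraph (GadgetVertex lit) :=
  satC4ComplGraph lit ⊔ SimpleGraph.fromEdgeSet (Set.range (addedEdge lit (fun x _ => α x) σ))

theorem not_ladderAdj_of_diagonalAdj {n : ℕ} (hn : 8 ≤ n) {o : Bool} {δ δ' : ℤ} {r r' : Fin 4}
    {k : ℤ} (h : DiagonalAdj o δ r r') (hd : (n : ℤ) ∣ k - δ) (h' : LadderAdj none δ' r r')
    (hd' : (n : ℤ) ∣ k - δ') : False := by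
  have h1 : (n : ℤ) ∣ δ' - δ := by
    have := dvd_sub hd hd'
    rwa [sub_sub_sub_cancel_left] at this
  have h2 := h'.abs_le
  have h3 : -1 ≤ δ ∧ δ ≤ 1 := (ladderAdj_some_iff.2 (Or.inr h)).abs_le
  have h4 := Int.eq_zero_of_abs_lt_dvd h1 (by rw [abs_lt]; omega)
  obtain rfl : δ' = δ := by omega
  rcases h with ⟨rfl, rfl, rfl⟩ | ⟨rfl, rfl, rfl⟩ <;> cases o <;> revert h' <;> decide

theorem addedEdge_not_isDiag (k : AddedIndex lit) : ¬ (addedEdge lit o σ k).IsDiag := by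
  have : ∀ a, clauseV a ≠ clauseU a := by decide
  rcases k with ⟨x, i⟩ | ⟨c, e⟩ <;> simp only [addedEdge] <;> split_ifs <;> simp [this]

theorem completion_adj (v w : GadgetVertex lit) :
    (completion lit α σ).Adj v w ↔ (satC4ComplGraph lit).Adj v w ∨
      s(v, w) ∈ Set.range (addedEdge lit (fun x _ => α x) σ) := by
  rw [completion, SimpleGraph.sup_adj, SimpleGraph.fromEdgeSet_adj]
  refine or_congr_right ⟨And.left, fun h => ⟨h, ?_⟩⟩
  rintro rfl
  obtain ⟨k, hk⟩ := h
  exact addedEdge_not_isDiag lit (fun x _ => α x) σ k (by rw [hk]; rfl)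

theorem disjoint_range_addedEdge (hocc : ∀ x : Var, 2 ≤ numOcc lit x) :
    Disjoint (Set.range (addedEdge lit (fun x _ => α x) σ)) (satC4ComplGraph lit).edgeSet := by
  rw [Set.disjoint_left]
  intro e
  induction e using Sym2.ind with | _ v w => ?_
  intro h hG
  rw [SimpleGraph.mem_edgeSet] at hG
  rcases v with ⟨x, i, r⟩ | ⟨c, s | p⟩ <;> rcases w with ⟨y, j, r'⟩ | ⟨d, s' | p'⟩
  · rw [inl_inl_mem_range_addedEdge] at h
    rw [satC4ComplGraph_adj_inl_inl lit hocc] at hG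
    obtain ⟨rfl, δ, hδ, hd⟩ := h
    obtain ⟨-, δ', hδ', hd'⟩ := hG
    exact not_ladderAdj_of_diagonalAdj (by have := hocc x; omega) hδ hd hδ' hd'
  · exact inl_inr_notMem_range_addedEdge _ _ _ _ _ h
  · exact inl_inr_notMem_range_addedEdge _ _ _ _ _ h
  · exact inl_inr_notMem_range_addedEdge _ _ _ _ _ (Sym2.eq_swap ▸ h)
  · rw [core_core_mem_range_addedEdge] at h
    rw [satC4ComplGraph_adj_core_core] at hG
    have key : ∀ (a : Fin 3) (s s' : Fin 8), CoreAdj none s s' →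
        ¬ (s(s, s') = s(clauseV a, clauseU a) ∨
          s(s, s') = if a = 2 then s(2, 3) else s(0, 1)) := by decide
    exact key _ _ _ hG.2 h.2
  · exact path_notMem_range_addedEdge _ _ _ _ _ _ h
  · exact inl_inr_notMem_range_addedEdge _ _ _ _ _ (Sym2.eq_swap ▸ h)
  · exact path_notMem_range_addedEdge _ _ _ _ _ _ (Sym2.eq_swap ▸ h)
  · exact path_notMem_range_addedEdge _ _ _ _ _ _ h

theorem completion_adj_inl_inl (hocc : ∀ x : Var, 2 ≤ numOcc lit x) (x y : Var)
    (i : Fin (4 * numOcc lit x)) (j : Fin (4 * numOcc lit y)) (r r' : Fin 4) :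
    (completion lit α σ).Adj (Sum.inl ⟨x, i, r⟩) (Sum.inl ⟨y, j, r'⟩) ↔
      x = y ∧ ∃ δ : ℤ, LadderAdj (some (α x)) δ r r' ∧
        ((4 * numOcc lit x : ℕ) : ℤ) ∣ (j : ℤ) - (i : ℤ) - δ := by
  simp only [completion_adj, satC4ComplGraph_adj_inl_inl lit hocc, inl_inl_mem_range_addedEdge,
    ladderAdj_some_iff, or_and_right, exists_or, and_or_left]

theorem completion_adj_inl_core (x : Var) (i : Fin (4 * numOcc lit x)) (r : Fin 4)
    (c : Fin m) (s : Fin 8) :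
    (completion lit α σ).Adj (Sum.inl ⟨x, i, r⟩) (Sum.inr (c, Sum.inl s)) ↔
      CrossAdj lit x i r c s := by
  simp only [completion_adj, satC4ComplGraph_adj_inl_core, inl_inr_notMem_range_addedEdge,
    or_false]

theorem completion_not_adj_inl_path (w : Σ x : Var, Fin (4 * numOcc lit x) × Fin 4)
    (c : Fin m) (p : Fin (14 * m) × Fin 2) :
    ¬ (completion lit α σ).Adj (Sum.inl w) (Sum.inr (c, Sum.inr p)) := by
  simp only [completion_adj, satC4ComplGraph_not_adj_inl_path, inl_inr_notMem_range_addedEdge,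
    or_false, not_false_eq_true]

theorem completion_adj_core_core (c d : Fin m) (s s' : Fin 8) :
    (completion lit α σ).Adj (Sum.inr (c, Sum.inl s)) (Sum.inr (d, Sum.inl s')) ↔
      c = d ∧ CoreAdj (some (σ c)) s s' := by
  rw [completion_adj, satC4ComplGraph_adj_core_core, core_core_mem_range_addedEdge,
    coreAdj_some_iff, and_or_left]
  rfl

theorem completion_adj_core_path (c d : Fin m) (s : Fin 8) (q : Fin (14 * m)) (e : Fin 2) :
    (completion lit α σ).Adj (Sum.inr (c, Sum.inl s)) (Sum.inr (d, Sum.inr (q, e))) ↔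
      c = d ∧ ((s = 3 ∧ e = 0) ∨ (s = 7 ∧ e = 1)) := by
  simp only [completion_adj, satC4ComplGraph_adj_core_path, path_notMem_range_addedEdge, or_false]

theorem completion_adj_path_core (c d : Fin m) (s : Fin 8) (q : Fin (14 * m)) (e : Fin 2) :
    (completion lit α σ).Adj (Sum.inr (d, Sum.inr (q, e))) (Sum.inr (c, Sum.inl s)) ↔
      c = d ∧ ((s = 3 ∧ e = 0) ∨ (s = 7 ∧ e = 1)) := by
  rw [SimpleGraph.adj_comm, completion_adj_core_path]

theorem completion_adj_path_path (c d : Fin m) (q q' : Fin (14 * m)) (e e' : Fin 2) :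
    (completion lit α σ).Adj (Sum.inr (c, Sum.inr (q, e))) (Sum.inr (d, Sum.inr (q', e'))) ↔
      c = d ∧ q = q' ∧ e ≠ e' := by
  simp only [completion_adj, satC4ComplGraph_adj_path_path, path_notMem_range_addedEdge, or_false]

variable {lit} in
theorem CrossAdj.clause_unique
    (hdist : ∀ c, Function.Injective (fun a : Fin 3 => (lit c a).1)) {x : Var} {i : ℕ}
    {r : Fin 4} {c d : Fin m} {s t : Fin 8} (h : CrossAdj lit x i r c s)
    (h' : CrossAdj lit x i r d t) : c = d ∧ s = t := by
  obtain ⟨a, ha, hs⟩ := h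
  obtain ⟨b, hb, ht⟩ := h'
  have hle := fun e : Bool => Bool.toNat_le e
  have h1 := hle (lit c a).2
  have h2 := hle (!(lit c a).2)
  have h3 := hle (lit d b).2
  have h4 := hle (!(lit d b).2)
  have hcd : c = d := occIdx_injective lit ⟨a, ha⟩ ⟨b, hb⟩ (by omega)
  subst hcd
  obtain rfl : a = b := hdist c (ha.trans hb.symm)
  refine ⟨rfl, Fin.ext ?_⟩
  rcases hs with ⟨rfl, -, hs⟩ | ⟨rfl, -, hs⟩ <;> rcases ht with ⟨h, -, ht⟩ | ⟨h, -, ht⟩ <;>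
    omega

variable {lit} in
theorem CrossAdj.rung_unique {x y : Var} {i j : ℕ}
    {r r' : Fin 4} {c : Fin m} {s : Fin 8} (h : CrossAdj lit x i r c s)
    (h' : CrossAdj lit y j r' c s) : x = y ∧ i = j ∧ r = r' := by
  obtain ⟨a, rfl, hs⟩ := h
  obtain ⟨b, rfl, ht⟩ := h'
  have : a = b := by omega
  subst this
  refine ⟨rfl, ?_⟩
  rcases hs with ⟨rfl, hi, hs⟩ | ⟨rfl, hi, hs⟩ <;> rcases ht with ⟨rfl, hj, ht⟩ | ⟨rfl, hj, ht⟩ <;>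
    omega

theorem completion_inr_unique
    (hdist : ∀ c, Function.Injective (fun a : Fin 3 => (lit c a).1))
    {w : Σ x : Var, Fin (4 * numOcc lit x) × Fin 4}
    {z z' : Fin m × (Fin 8 ⊕ Fin (14 * m) × Fin 2)}
    (h : (completion lit α σ).Adj (Sum.inl w) (Sum.inr z))
    (h' : (completion lit α σ).Adj (Sum.inl w) (Sum.inr z')) : z = z' := by
  obtain ⟨x, i, r⟩ := w
  obtain ⟨c, s | p⟩ := z
  · obtain ⟨d, t | p⟩ := z'
    · rw [completion_adj_inl_core] at h h'
      obtain ⟨rfl, rfl⟩ := h.clause_unique hdist h'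
      rfl
    · exact (completion_not_adj_inl_path _ _ _ _ _ _ h').elim
  · exact (completion_not_adj_inl_path _ _ _ _ _ _ h).elim

theorem completion_inl_unique
    {w w' : Σ x : Var, Fin (4 * numOcc lit x) × Fin 4}
    {z : Fin m × (Fin 8 ⊕ Fin (14 * m) × Fin 2)}
    (h : (completion lit α σ).Adj (Sum.inl w) (Sum.inr z))
    (h' : (completion lit α σ).Adj (Sum.inl w') (Sum.inr z)) : w = w' := by
  obtain ⟨x, i, r⟩ := w
  obtain ⟨y, j, r'⟩ := w'
  obtain ⟨c, s | p⟩ := z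
  · rw [completion_adj_inl_core] at h h'
    obtain ⟨rfl, hij, rfl⟩ := h.rung_unique h'
    obtain rfl : i = j := Fin.ext hij
    rfl
  · exact (completion_not_adj_inl_path _ _ _ _ _ _ h).elim

/-- No 4-cycle runs through exactly one square side of a variable gadget and one edge of a
clause gadget. -/
theorem completion_no_crossing_square (hocc : ∀ x : Var, 2 ≤ numOcc lit x)
    (hdist : ∀ c, Function.Injective (fun a : Fin 3 => (lit c a).1))
    (hσ : ∀ c, α (lit c (σ c)).1 = (lit c (σ c)).2)
    {w w' : Σ x : Var, Fin (4 * numOcc lit x) × Fin 4}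
    {z z' : Fin m × (Fin 8 ⊕ Fin (14 * m) × Fin 2)}
    (hw : (completion lit α σ).Adj (Sum.inl w) (Sum.inl w'))
    (hz : (completion lit α σ).Adj (Sum.inr z') (Sum.inr z))
    (h : (completion lit α σ).Adj (Sum.inl w) (Sum.inr z))
    (h' : (completion lit α σ).Adj (Sum.inl w') (Sum.inr z')) : False := by
  obtain ⟨x, i, r⟩ := w
  obtain ⟨y, j, r'⟩ := w'
  obtain ⟨c, s | p⟩ := z
  swap
  · exact (completion_not_adj_inl_path _ _ _ _ _ _ h).elim
  obtain ⟨d, s' | p'⟩ := z'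
  swap
  · exact (completion_not_adj_inl_path _ _ _ _ _ _ h').elim
  rw [completion_adj_inl_inl lit α σ hocc] at hw
  rw [completion_adj_core_core] at hz
  rw [completion_adj_inl_core] at h h'
  obtain ⟨rfl, hs⟩ := hz
  obtain ⟨rfl, δ, hδ, hd⟩ := hw
  obtain ⟨a, rfl, ha⟩ := h
  obtain ⟨b, hb, hb'⟩ := h'
  obtain rfl : b = a := hdist d hb
  have hδ1 := hδ.abs_le
  have hle := fun e : Bool => Bool.toNat_le e
  have h1 := hle (lit d b).2
  have h2 := hle (!(lit d b).2)
  have hn := hocc (lit d b).1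
  have key : ∀ (a b : Fin 3) (s s' : Fin 8), CoreAdj (some a) s s' →
      ((s : ℕ) = b ∧ (s' : ℕ) = b + 4 ∨ (s' : ℕ) = b ∧ (s : ℕ) = b + 4) → b = a := by decide
  have irr : ∀ (a : Fin 3) (s : Fin 8), ¬ CoreAdj (some a) s s := by decide
  have hss : s' ≠ s := by rintro rfl; exact irr _ _ hs
  have hss' : (s' : ℕ) ≠ s := fun h => hss (Fin.ext h)
  have hbσ : b = σ d := key _ _ _ _ hs (by omega)
  have hα : α (lit d b).1 = (lit d b).2 := by rw [hbσ]; exact hσ d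
  rw [hα] at hδ
  have hδ2 : δ = (j : ℤ) - (i : ℤ) := by
    have := Int.eq_zero_of_abs_lt_dvd hd (by rw [abs_lt]; omega)
    omega
  rcases ha with ⟨rfl, hi, hsa⟩ | ⟨rfl, hi, hsa⟩ <;>
    rcases hb' with ⟨rfl, hj, hsb⟩ | ⟨rfl, hj, hsb⟩ <;>
    (try omega) <;> rcases hlit : (lit d b).2 with _ | _ <;>
    simp only [hlit, Bool.toNat_true, Bool.toNat_false, Bool.not_true, Bool.not_false] at hi hj hδ
  · obtain rfl : δ = 1 := by omega
    revert hδ; decide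
  · obtain rfl : δ = -1 := by omega
    revert hδ; decide
  · obtain rfl : δ = -1 := by omega
    revert hδ; decide
  · obtain rfl : δ = 1 := by omega
    revert hδ; decide

/-- The inner vertices of the paths of a clause gadget lie on no 4-cycle of clause vertices. -/
theorem completion_path_not_on_square {c₀ : Fin m} {p : Fin (14 * m) × Fin 2}
    {z₁ z₂ z₃ : Fin m × (Fin 8 ⊕ Fin (14 * m) × Fin 2)}
    (h₁ : (completion lit α σ).Adj (Sum.inr (c₀, Sum.inr p)) (Sum.inr z₁))
    (h₂ : (completion lit α σ).Adj (Sum.inr z₁) (Sum.inr z₂))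
    (h₃ : (completion lit α σ).Adj (Sum.inr z₂) (Sum.inr z₃))
    (h₄ : (completion lit α σ).Adj (Sum.inr z₃) (Sum.inr (c₀, Sum.inr p)))
    (h₀₂ : (c₀, Sum.inr p) ≠ z₂) (h₁₃ : z₁ ≠ z₃) : False := by
  have h37 : ∀ a, ¬ CoreAdj (some a) 3 7 ∧ ¬ CoreAdj (some a) 7 3 := by decide
  obtain ⟨q, e⟩ := p
  obtain ⟨c₁, s₁ | ⟨q₁, e₁⟩⟩ := z₁ <;> obtain ⟨c₂, s₂ | ⟨q₂, e₂⟩⟩ := z₂ <;>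
    obtain ⟨c₃, s₃ | ⟨q₃, e₃⟩⟩ := z₃ <;>
    simp only [completion_adj_core_core, completion_adj_core_path, completion_adj_path_core,
      completion_adj_path_path] at h₁ h₂ h₃ h₄ <;>
    grind

theorem completion_adj_or_eq_of_ladderAdj (hocc : ∀ x : Var, 2 ≤ numOcc lit x) {x : Var}
    {i j : Fin (4 * numOcc lit x)} {δ : ℤ} {r r' : Fin 4}
    (h : LadderAdj (some (α x)) δ r r' ∨ (δ = 0 ∧ r = r'))
    (hd : ((4 * numOcc lit x : ℕ) : ℤ) ∣ (j : ℤ) - (i : ℤ) - δ)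
    (hne : (Sum.inl ⟨x, i, r⟩ : GadgetVertex lit) ≠ Sum.inl ⟨x, j, r'⟩) :
    (completion lit α σ).Adj (Sum.inl ⟨x, i, r⟩) (Sum.inl ⟨x, j, r'⟩) := by
  rcases h with h | ⟨rfl, rfl⟩
  · rw [completion_adj_inl_inl lit α σ hocc]
    exact ⟨rfl, δ, h, hd⟩
  · rw [sub_zero, int_dvd_sub_iff i.2 j.2] at hd
    exact absurd (by rw [Fin.ext hd]) hne

theorem completion_exists_chord_inl (hocc : ∀ x : Var, 2 ≤ numOcc lit x)
    {w₀ w₁ w₂ w₃ : Σ x : Var, Fin (4 * numOcc lit x) × Fin 4}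
    (h₁ : (completion lit α σ).Adj (Sum.inl w₀) (Sum.inl w₁))
    (h₂ : (completion lit α σ).Adj (Sum.inl w₁) (Sum.inl w₂))
    (h₃ : (completion lit α σ).Adj (Sum.inl w₂) (Sum.inl w₃))
    (h₄ : (completion lit α σ).Adj (Sum.inl w₃) (Sum.inl w₀))
    (h₀₂ : (Sum.inl w₀ : GadgetVertex lit) ≠ Sum.inl w₂)
    (h₁₃ : (Sum.inl w₁ : GadgetVertex lit) ≠ Sum.inl w₃) :
    (completion lit α σ).Adj (Sum.inl w₀) (Sum.inl w₂) ∨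
      (completion lit α σ).Adj (Sum.inl w₁) (Sum.inl w₃) := by
  obtain ⟨x, i₀, r₀⟩ := w₀
  obtain ⟨x₁, i₁, r₁⟩ := w₁
  obtain ⟨x₂, i₂, r₂⟩ := w₂
  obtain ⟨x₃, i₃, r₃⟩ := w₃
  rw [completion_adj_inl_inl lit α σ hocc] at h₁ h₂ h₃ h₄
  obtain ⟨rfl, δ₁, hl₁, hd₁⟩ := h₁
  obtain ⟨rfl, δ₂, hl₂, hd₂⟩ := h₂
  obtain ⟨rfl, δ₃, hl₃, hd₃⟩ := h₃
  obtain ⟨-, δ₄, hl₄, hd₄⟩ := h₄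
  have hn := hocc x
  have b₁ := hl₁.abs_le
  have b₂ := hl₂.abs_le
  have b₃ := hl₃.abs_le
  have b₄ := hl₄.abs_le
  have hsum : δ₁ + δ₂ + δ₃ + δ₄ = 0 := by
    have h : ((4 * numOcc lit x : ℕ) : ℤ) ∣ δ₁ + δ₂ + δ₃ + δ₄ := by
      have := Int.dvd_neg.2 (Int.dvd_add (Int.dvd_add hd₁ hd₂) (Int.dvd_add hd₃ hd₄))
      convert this using 1; ring
    exact Int.eq_zero_of_abs_lt_dvd h (by rw [abs_lt]; omega)
  refine (LadderAdj.exists_chord hl₁ hl₂ hl₃ hl₄ hsum).imp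
    (fun h => completion_adj_or_eq_of_ladderAdj lit α σ hocc h ?_ h₀₂)
    (fun h => completion_adj_or_eq_of_ladderAdj lit α σ hocc h ?_ h₁₃)
  · convert Int.dvd_add hd₁ hd₂ using 1; ring
  · convert Int.dvd_add hd₂ hd₃ using 1; ring

theorem completion_exists_chord_inr {z₀ z₁ z₂ z₃ : Fin m × (Fin 8 ⊕ Fin (14 * m) × Fin 2)}
    (h₁ : (completion lit α σ).Adj (Sum.inr z₀) (Sum.inr z₁))
    (h₂ : (completion lit α σ).Adj (Sum.inr z₁) (Sum.inr z₂))
    (h₃ : (completion lit α σ).Adj (Sum.inr z₂) (Sum.inr z₃))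
    (h₄ : (completion lit α σ).Adj (Sum.inr z₃) (Sum.inr z₀))
    (h₀₂ : z₀ ≠ z₂) (h₁₃ : z₁ ≠ z₃) :
    (completion lit α σ).Adj (Sum.inr z₀) (Sum.inr z₂) ∨
      (completion lit α σ).Adj (Sum.inr z₁) (Sum.inr z₃) := by
  obtain ⟨c₀, s₀ | p₀⟩ := z₀
  swap
  · exact (completion_path_not_on_square lit α σ h₁ h₂ h₃ h₄ h₀₂ h₁₃).elim
  obtain ⟨c₁, s₁ | p₁⟩ := z₁
  swap
  · exact (completion_path_not_on_square lit α σ h₂ h₃ h₄ h₁ h₁₃ h₀₂.symm).elim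
  obtain ⟨c₂, s₂ | p₂⟩ := z₂
  swap
  · exact (completion_path_not_on_square lit α σ h₃ h₄ h₁ h₂ h₀₂.symm h₁₃.symm).elim
  obtain ⟨c₃, s₃ | p₃⟩ := z₃
  swap
  · exact (completion_path_not_on_square lit α σ h₄ h₁ h₂ h₃ h₁₃.symm h₀₂).elim
  rw [completion_adj_core_core] at h₁ h₂ h₃ h₄
  obtain ⟨rfl, h₁⟩ := h₁
  obtain ⟨rfl, h₂⟩ := h₂
  obtain ⟨rfl, h₃⟩ := h₃
  rw [completion_adj_core_core, completion_adj_core_core]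
  refine (CoreAdj.exists_chord _ _ _ h₁ _ h₂ ?_ _ h₃ h₄.2 ?_).imp (⟨rfl, ·⟩) (⟨rfl, ·⟩)
  · rintro rfl; exact h₀₂ rfl
  · rintro rfl; exact h₁₃ rfl

theorem isEmpty_cycleGraph_four_embedding_completion (hocc : ∀ x : Var, 2 ≤ numOcc lit x)
    (hdist : ∀ c, Function.Injective (fun a : Fin 3 => (lit c a).1))
    (hσ : ∀ c, α (lit c (σ c)).1 = (lit c (σ c)).2) :
    IsEmpty (SimpleGraph.cycleGraph 4 ↪g completion lit α σ) := by
  rw [isEmpty_cycleGraph_four_embedding_iff]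
  have cross := @completion_no_crossing_square _ _ _ lit α σ hocc hdist hσ
  have right := @completion_inr_unique _ _ _ lit α σ hdist
  have left := @completion_inl_unique _ _ _ lit α σ
  rintro (a | a) (b | b) (c | c) (d | d) hab hbc hcd hda hac hbd
  · exact completion_exists_chord_inl lit α σ hocc hab hbc hcd hda hac hbd
  · exact (hac (congrArg _ (left hda.symm hcd))).elim
  · exact (hbd (congrArg _ (left hbc hcd.symm))).elim
  · exact (cross hab hcd hda.symm hbc).elim
  · exact (hac (congrArg _ (left hab hbc.symm))).elim
  · exact (hac (congrArg _ (left hab hbc.symm))).elim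
  · exact (cross hda hbc hcd.symm hab).elim
  · exact (hbd (congrArg _ (right hab hda.symm))).elim
  · exact (hbd (congrArg _ (left hab.symm hda))).elim
  · exact (cross hbc hda hab.symm hcd).elim
  · exact (hbd (congrArg _ (left hab.symm hda))).elim
  · exact (hac (congrArg _ (right hab.symm hbc))).elim
  · exact (cross hcd hab hbc.symm hda).elim
  · exact (hbd (congrArg _ (right hbc.symm hcd))).elim
  · exact (hac (congrArg _ (right hda hcd.symm))).elim
  · exact (completion_exists_chord_inr lit α σ hab hbc hcd hda (fun h => hac (h ▸ rfl))
      (fun h => hbd (h ▸ rfl)))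

theorem nextRung_ne_of_eq {n : ℕ} (hn : 3 ≤ n) {i j : Fin n} (h : j = nextRung i) :
    i ≠ nextRung j := by
  intro h'
  rw [eq_nextRung_iff] at h h'
  have := Int.dvd_add h h'
  have := Int.eq_zero_of_abs_lt_dvd this (by rw [abs_lt]; omega)
  omega

theorem nextRung_injective {n : ℕ} : Function.Injective (nextRung : Fin n → Fin n) := by
  intro i j h
  have h1 := eq_nextRung_iff.1 (rfl : nextRung i = nextRung i)
  have h2 := eq_nextRung_iff.1 (rfl : nextRung j = nextRung j)
  rw [h] at h1
  have := Int.dvd_sub h1 h2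
  refine Fin.ext ((int_dvd_sub_iff j.2 i.2).1 ?_)
  rw [← Int.dvd_neg]
  convert this using 1; ring

theorem addedEdge_injective (hocc : ∀ x : Var, 2 ≤ numOcc lit x) :
    Function.Injective (addedEdge lit o σ) := by
  have h1 : ∀ a : Fin 3, (2 : Fin 8) ≠ clauseV a ∨ 3 ≠ clauseU a := by decide
  have h2 : ∀ a : Fin 3, (2 : Fin 8) ≠ clauseU a ∨ 3 ≠ clauseV a := by decide
  have h3 : ∀ a : Fin 3, (0 : Fin 8) ≠ clauseV a ∨ 1 ≠ clauseU a := by decide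
  have h4 : ∀ a : Fin 3, (0 : Fin 8) ≠ clauseU a ∨ 1 ≠ clauseV a := by decide
  rintro (⟨x, i⟩ | ⟨c, e⟩) (⟨y, j⟩ | ⟨d, f⟩) h
  · by_cases hxy : x = y
    · subst hxy
      have hn := hocc x
      have := @nextRung_ne_of_eq (4 * numOcc lit x) (by omega)
      have := @nextRung_injective (4 * numOcc lit x)
      simp only [addedEdge] at h
      split_ifs at h <;> simp at h <;> grind
    · simp only [addedEdge] at h
      split_ifs at h <;> simp [hxy] at h
  · simp only [addedEdge] at h
    split_ifs at h <;> simp at h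
  · simp only [addedEdge] at h
    split_ifs at h <;> simp at h
  · have he : c = d := by
      simp only [addedEdge] at h
      split_ifs at h <;> simp at h <;> grind
    subst he
    simp only [addedEdge] at h
    split_ifs at h <;> simp at h <;> grind

theorem finite_var (hocc : ∀ x : Var, 2 ≤ numOcc lit x) : Finite Var := by
  refine Finite.of_surjective (fun p : Fin m × Fin 3 => (lit p.1 p.2).1) fun x => ?_
  have : 0 < numOcc lit x := by have := hocc x; omega
  obtain ⟨c, hc⟩ := Finset.card_pos.1 this
  obtain ⟨a, ha⟩ := (Finset.mem_filter.1 hc).2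
  exact ⟨(c, a), ha⟩

theorem sum_numOcc [Fintype Var]
    (hdist : ∀ c, Function.Injective (fun a : Fin 3 => (lit c a).1)) :
    ∑ x, numOcc lit x = 3 * m := by
  have h : ∀ c : Fin m,
      (Finset.univ.filter fun x : Var => ∃ a : Fin 3, (lit c a).1 = x).card = 3 := by
    intro c
    have : (Finset.univ.filter fun x : Var => ∃ a : Fin 3, (lit c a).1 = x) =
        Finset.univ.image (fun a : Fin 3 => (lit c a).1) := by
      ext x; simp
    rw [this, Finset.card_image_of_injective _ (hdist c), Finset.card_univ, Fintype.card_fin]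
  simp only [numOcc, Finset.card_filter] at h ⊢
  rw [Finset.sum_comm]
  simp [h, mul_comm]

theorem card_addedIndex (hocc : ∀ x : Var, 2 ≤ numOcc lit x)
    (hdist : ∀ c, Function.Injective (fun a : Fin 3 => (lit c a).1)) :
    Nat.card (AddedIndex lit) = 14 * m := by
  have := finite_var lit hocc
  have := Fintype.ofFinite Var
  rw [Nat.card_eq_fintype_card, Fintype.card_sum, Fintype.card_sigma, Fintype.card_prod]
  simp only [Fintype.card_fin]
  rw [← Finset.mul_sum, sum_numOcc lit hdist]
  omega

variable {lit}

theorem satC4ComplGraph_adj_rung (hocc : ∀ x : Var, 2 ≤ numOcc lit x) {x : Var}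
    (i : Fin (4 * numOcc lit x)) {r r' : Fin 4} (h : (r, r') ∈ rungPairs) :
    (satC4ComplGraph lit).Adj (Sum.inl ⟨x, i, r⟩) (Sum.inl ⟨x, i, r'⟩) :=
  (satC4ComplGraph_adj_inl_inl lit hocc x x i i r r').2
    ⟨rfl, 0, Or.inl ⟨rfl, Or.inl h⟩, by simp⟩

theorem satC4ComplGraph_adj_step (hocc : ∀ x : Var, 2 ≤ numOcc lit x) {x : Var}
    (i : Fin (4 * numOcc lit x)) {r r' : Fin 4} (h : (r, r') ∈ stepPairs none) :
    (satC4ComplGraph lit).Adj (Sum.inl ⟨x, i, r⟩) (Sum.inl ⟨x, nextRung i, r'⟩) :=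
  (satC4ComplGraph_adj_inl_inl lit hocc x x i (nextRung i) r r').2
    ⟨rfl, 1, Or.inr (Or.inl ⟨rfl, h⟩), eq_nextRung_iff.1 rfl⟩

theorem satC4ComplGraph_not_adj_of_not_ladderAdj (hocc : ∀ x : Var, 2 ≤ numOcc lit x) {x : Var}
    {i j : Fin (4 * numOcc lit x)} {r r' : Fin 4} (δ : ℤ) (hδ : |δ| ≤ 2)
    (hd : ((4 * numOcc lit x : ℕ) : ℤ) ∣ (j : ℤ) - (i : ℤ) - δ)
    (h : ¬ LadderAdj none δ r r') :
    ¬ (satC4ComplGraph lit).Adj (Sum.inl ⟨x, i, r⟩) (Sum.inl ⟨x, j, r'⟩) := by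
  rw [satC4ComplGraph_adj_inl_inl lit hocc]
  rintro ⟨-, δ', hl, hd'⟩
  have hn := hocc x
  have := hl.abs_le
  rw [abs_le] at hδ
  have := Int.dvd_sub hd hd'
  rw [sub_sub_sub_cancel_left] at this
  have := Int.eq_zero_of_abs_lt_dvd this (by rw [abs_lt]; omega)
  obtain rfl : δ' = δ := by omega
  exact h hl

theorem nextRung_nextRung_dvd {n : ℕ} (i : Fin n) :
    (n : ℤ) ∣ (nextRung (nextRung i) : ℤ) - i - 2 := by
  have h1 := eq_nextRung_iff.1 (rfl : nextRung i = nextRung i)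
  have h2 := eq_nextRung_iff.1 (rfl : nextRung (nextRung i) = nextRung (nextRung i))
  convert Int.dvd_add h1 h2 using 1; ring

theorem nextRung_nextRung_ne {n : ℕ} (hn : 3 ≤ n) (i : Fin n) : i ≠ nextRung (nextRung i) :=
  nextRung_ne_of_eq hn rfl

theorem not_crossAdj_one_clauseU {x : Var} {i : ℕ} {c : Fin m} (a : Fin 3) :
    ¬ CrossAdj lit x i 1 c (clauseU a) := by
  rintro ⟨b, -, ⟨-, -, h⟩ | ⟨h, -⟩⟩
  · simp only [clauseU] at h; omega
  · exact absurd h (by decide)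

theorem not_crossAdj_two_clauseV {x : Var} {i : ℕ} {c : Fin m} (a : Fin 3) :
    ¬ CrossAdj lit x i 2 c (clauseV a) := by
  rintro ⟨b, -, ⟨h, -⟩ | ⟨-, -, h⟩⟩
  · exact absurd h (by decide)
  · simp only [clauseV] at h; omega

/-- `S` meets the diagonals of every 4-cycle of the completed graph whose diagonals are
non-edges of the original graph. -/
def HitsDiagonals {V : Type*} (G : SimpleGraph V) (S : Set (Sym2 V)) : Prop :=
  ∀ a b c d, (G.Adj a b ∨ s(a, b) ∈ S) → (G.Adj b c ∨ s(b, c) ∈ S) →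
    (G.Adj c d ∨ s(c, d) ∈ S) → (G.Adj d a ∨ s(d, a) ∈ S) → a ≠ c → b ≠ d →
    ¬ G.Adj a c → ¬ G.Adj b d → s(a, c) ∈ S ∨ s(b, d) ∈ S

theorem hitsDiagonals_of_isEmpty {V : Type*} {G : SimpleGraph V} {S : Set (Sym2 V)}
    (hS : ∀ e ∈ S, ¬ e.IsDiag)
    (h : IsEmpty (SimpleGraph.cycleGraph 4 ↪g (G ⊔ SimpleGraph.fromEdgeSet S))) :
    HitsDiagonals G S := by
  rw [isEmpty_cycleGraph_four_embedding_iff] at h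
  have key : ∀ v w, (G ⊔ SimpleGraph.fromEdgeSet S).Adj v w ↔ (G.Adj v w ∨ s(v, w) ∈ S) := by
    intro v w
    rw [SimpleGraph.sup_adj, SimpleGraph.fromEdgeSet_adj]
    refine or_congr_right ⟨And.left, fun h => ⟨h, ?_⟩⟩
    rintro rfl
    exact hS _ h rfl
  simp only [key] at h
  intro a b c d hab hbc hcd hda hac hbd nac nbd
  have := h a b c d hab hbc hcd hda hac hbd
  tauto

theorem exists_orientation (hocc : ∀ x : Var, 2 ≤ numOcc lit x)
    {S : Set (Sym2 (GadgetVertex lit))} (hS : HitsDiagonals (satC4ComplGraph lit) S) :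
    ∃ o : ∀ x, Fin (4 * numOcc lit x) → Bool, ∀ x i,
      (if o x i then s(Sum.inl ⟨x, i, 1⟩, Sum.inl ⟨x, nextRung i, 2⟩)
        else s(Sum.inl ⟨x, nextRung i, 1⟩, Sum.inl ⟨x, i, 2⟩)) ∈ S := by
  have : ∀ x (i : Fin (4 * numOcc lit x)), ∃ o : Bool,
      (if o then s(Sum.inl ⟨x, i, 1⟩, Sum.inl ⟨x, nextRung i, 2⟩)
        else s(Sum.inl ⟨x, nextRung i, 1⟩, Sum.inl ⟨x, i, 2⟩)) ∈ S := by
    intro x i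
    have h1 := eq_nextRung_iff.1 (rfl : nextRung i = nextRung i)
    have h2 := eq_nextRung_iff'.1 (rfl : nextRung i = nextRung i)
    rcases hS (Sum.inl ⟨x, i, 1⟩) (Sum.inl ⟨x, nextRung i, 1⟩) (Sum.inl ⟨x, nextRung i, 2⟩)
      (Sum.inl ⟨x, i, 2⟩) (Or.inl (satC4ComplGraph_adj_step hocc i (by decide)))
      (Or.inl (satC4ComplGraph_adj_rung hocc _ (by decide)))
      (Or.inl (satC4ComplGraph_adj_step hocc i (by decide)).symm)
      (Or.inl (satC4ComplGraph_adj_rung hocc _ (by decide)).symm) (by simp) (by simp)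
      (satC4ComplGraph_not_adj_of_not_ladderAdj hocc 1 (by decide) h1 (by decide))
      (satC4ComplGraph_not_adj_of_not_ladderAdj hocc (-1) (by decide) h2 (by decide)) with h | h
    · exact ⟨true, h⟩
    · exact ⟨false, h⟩
  choose o ho using this
  exact ⟨o, ho⟩

/-- Adding the pair `v^c_4 u^c_4` is too expensive. -/
theorem core_three_seven_notMem [Finite (GadgetVertex lit)]
    {S : Set (Sym2 (GadgetVertex lit))} (hS : HitsDiagonals (satC4ComplGraph lit) S)
    (hcard : S.ncard ≤ 14 * m) (c : Fin m) :
    s(Sum.inr (c, Sum.inl 3), Sum.inr (c, Sum.inl 7)) ∉ S := by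
  intro h
  have hq : ∀ q : Fin (14 * m), ∃ e ∈ S,
      e = s(Sum.inr (c, Sum.inl 3), Sum.inr (c, Sum.inr (q, 1))) ∨
      e = s(Sum.inr (c, Sum.inr (q, 0)), Sum.inr (c, Sum.inl 7)) := by
    intro q
    rcases hS (Sum.inr (c, Sum.inl 3)) (Sum.inr (c, Sum.inr (q, 0))) (Sum.inr (c, Sum.inr (q, 1)))
      (Sum.inr (c, Sum.inl 7)) (by simp [satC4ComplGraph_adj_core_path])
      (by simp [satC4ComplGraph_adj_path_path])
      (Or.inl ((satC4ComplGraph_adj_core_path lit c c 7 q 1).2 (by simp)).symm)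
      (Or.inr (Sym2.eq_swap ▸ h)) (by simp) (by simp)
      (by simp [satC4ComplGraph_adj_core_path])
      (fun h => absurd ((satC4ComplGraph_adj_core_path lit c c 7 q 0).1 h.symm)
        (by simp)) with h | h
    · exact ⟨_, h, Or.inl rfl⟩
    · exact ⟨_, h, Or.inr rfl⟩
  choose g hgS hg using hq
  have hinj : Function.Injective g := by
    intro q q' hqq
    rcases hg q with h1 | h1 <;> rcases hg q' with h2 | h2 <;> rw [h1, h2] at hqq <;>
      simp at hqq <;> exact hqq
  have hnot : s(Sum.inr (c, Sum.inl 3), Sum.inr (c, Sum.inl 7)) ∉ Set.range g := by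
    rintro ⟨q, hq⟩
    rcases hg q with h1 | h1 <;> rw [h1] at hq <;> simp at hq
  have hsub : insert s(Sum.inr (c, Sum.inl 3), Sum.inr (c, Sum.inl 7)) (Set.range g) ⊆ S :=
    Set.insert_subset h (Set.range_subset_iff.2 hgS)
  have := Set.ncard_le_ncard hsub
  rw [Set.ncard_insert_of_notMem hnot, Set.ncard_range_of_injective hinj, Nat.card_fin] at this
  omega

theorem exists_satisfied_position [Finite (GadgetVertex lit)]
    {S : Set (Sym2 (GadgetVertex lit))} (hS : HitsDiagonals (satC4ComplGraph lit) S)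
    (hcard : S.ncard ≤ 14 * m) :
    ∃ σ : Fin m → Fin 3, ∀ c,
      s(Sum.inr (c, Sum.inl (clauseV (σ c))), Sum.inr (c, Sum.inl (clauseU (σ c)))) ∈ S ∧
      (if σ c = 2 then s(Sum.inr (c, Sum.inl 2), Sum.inr (c, Sum.inl 3))
        else s(Sum.inr (c, Sum.inl 0), Sum.inr (c, Sum.inl 1))) ∈ S := by
  suffices ∀ c : Fin m, ∃ a : Fin 3,
      s(Sum.inr (c, Sum.inl (clauseV a)), Sum.inr (c, Sum.inl (clauseU a))) ∈ S ∧
      (if a = 2 then s(Sum.inr (c, Sum.inl 2), Sum.inr (c, Sum.inl 3))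
        else s(Sum.inr (c, Sum.inl 0), Sum.inr (c, Sum.inl 1))) ∈ S by
    choose σ hσ using this
    exact ⟨σ, hσ⟩
  intro c
  have adj : ∀ s s', CoreAdj none s s' →
      (satC4ComplGraph lit).Adj (Sum.inr (c, Sum.inl s)) (Sum.inr (c, Sum.inl s')) :=
    fun s s' h => (satC4ComplGraph_adj_core_core lit c c s s').2 ⟨rfl, h⟩
  have nadj : ∀ s s', ¬ CoreAdj none s s' →
      ¬ (satC4ComplGraph lit).Adj (Sum.inr (c, Sum.inl s)) (Sum.inr (c, Sum.inl s')) :=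
    fun s s' h h' => h ((satC4ComplGraph_adj_core_core lit c c s s').1 h').2
  have h37 := core_three_seven_notMem hS hcard c
  rcases hS (Sum.inr (c, Sum.inl 0)) (Sum.inr (c, Sum.inl 2)) (Sum.inr (c, Sum.inl 1))
    (Sum.inr (c, Sum.inl 3)) (Or.inl (adj _ _ (by decide))) (Or.inl (adj _ _ (by decide)))
    (Or.inl (adj _ _ (by decide))) (Or.inl (adj _ _ (by decide))) (by simp) (by simp)
    (nadj _ _ (by decide)) (nadj _ _ (by decide)) with h | h
  · rcases hS (Sum.inr (c, Sum.inl 0)) (Sum.inr (c, Sum.inl 1)) (Sum.inr (c, Sum.inl 4))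
      (Sum.inr (c, Sum.inl 5)) (Or.inr h) (Or.inl (adj _ _ (by decide)))
      (Or.inl (adj _ _ (by decide))) (Or.inl (adj _ _ (by decide))) (by simp) (by simp)
      (nadj _ _ (by decide)) (nadj _ _ (by decide)) with h' | h'
    · exact ⟨0, h', h⟩
    · exact ⟨1, h', h⟩
  · rcases hS (Sum.inr (c, Sum.inl 2)) (Sum.inr (c, Sum.inl 3)) (Sum.inr (c, Sum.inl 6))
      (Sum.inr (c, Sum.inl 7)) (Or.inr h) (Or.inl (adj _ _ (by decide)))
      (Or.inl (adj _ _ (by decide))) (Or.inl (adj _ _ (by decide))) (by simp) (by simp)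
      (nadj _ _ (by decide)) (nadj _ _ (by decide)) with h' | h'
    · exact ⟨2, h', h⟩
    · exact absurd h' h37

theorem exists_eq_range_addedEdge [Finite (GadgetVertex lit)]
    (hocc : ∀ x : Var, 2 ≤ numOcc lit x)
    (hdist : ∀ c, Function.Injective (fun a : Fin 3 => (lit c a).1))
    {S : Set (Sym2 (GadgetVertex lit))} (hS : HitsDiagonals (satC4ComplGraph lit) S)
    (hcard : S.ncard ≤ 14 * m) :
    ∃ o σ, S = Set.range (addedEdge lit o σ) := by
  obtain ⟨o, ho⟩ := exists_orientation hocc hS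
  obtain ⟨σ, hσ⟩ := exists_satisfied_position hS hcard
  refine ⟨o, σ, (Set.eq_of_subset_of_ncard_le (Set.range_subset_iff.2 ?_) ?_).symm⟩
  · rintro (⟨x, i⟩ | ⟨c, e⟩)
    · exact ho x i
    · simp only [addedEdge]
      split_ifs with h1 h2
      · simpa [h2] using (hσ c).2
      · simpa [h2] using (hσ c).2
      · exact (hσ c).1
  · rw [Set.ncard_range_of_injective (addedEdge_injective lit o σ hocc),
      card_addedIndex lit hocc hdist]
    exact hcard

theorem labels_of_inl_inl_mem_range_addedEdge {x y : Var} {i : Fin (4 * numOcc lit x)}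
    {j : Fin (4 * numOcc lit y)} {r r' : Fin 4}
    (h : s(Sum.inl ⟨x, i, r⟩, Sum.inl ⟨y, j, r'⟩) ∈ Set.range (addedEdge lit o σ)) :
    (r = 1 ∧ r' = 2) ∨ (r = 2 ∧ r' = 1) := by
  obtain ⟨⟨z, k⟩ | ⟨d, f⟩, h⟩ := h
  · simp only [addedEdge] at h
    split_ifs at h <;>
      simp only [Sym2.eq_iff, Sum.inl.injEq, Sigma.mk.injEq] at h <;>
      rcases h with ⟨⟨rfl, h1⟩, ⟨rfl, h2⟩⟩ | ⟨⟨rfl, h1⟩, ⟨rfl, h2⟩⟩ <;>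
      simp only [heq_eq_eq, Prod.mk.injEq] at h1 h2 <;> simp [← h1.2, ← h2.2]
  · simp only [addedEdge] at h
    split_ifs at h <;> simp at h

variable {o σ}

theorem orientation_nextRung (hocc : ∀ x : Var, 2 ≤ numOcc lit x)
    (hS : HitsDiagonals (satC4ComplGraph lit) (Set.range (addedEdge lit o σ))) (x : Var)
    (i : Fin (4 * numOcc lit x)) : o x (nextRung i) = o x i := by
  have hn := hocc x
  have hne := nextRung_nextRung_ne (by omega) i
  have hd := nextRung_nextRung_dvd i
  have hlab : ∀ {j k : Fin (4 * numOcc lit x)} {r r' : Fin 4},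
      ¬ ((r = 1 ∧ r' = 2) ∨ (r = 2 ∧ r' = 1)) →
      s(Sum.inl ⟨x, j, r⟩, Sum.inl ⟨x, k, r'⟩) ∉ Set.range (addedEdge lit o σ) :=
    fun h h' => h (labels_of_inl_inl_mem_range_addedEdge o σ h')
  have hzero : ((4 * numOcc lit x : ℕ) : ℤ) ∣
    ((nextRung i : ℕ) : ℤ) - ((nextRung i : ℕ) : ℤ) - 0 := by simp
  have m1 : addedEdge lit o σ (Sum.inl ⟨x, i⟩) ∈ Set.range (addedEdge lit o σ) := ⟨_, rfl⟩
  have m2 : addedEdge lit o σ (Sum.inl ⟨x, nextRung i⟩) ∈ Set.range (addedEdge lit o σ) :=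
    ⟨_, rfl⟩
  simp only [addedEdge] at m1 m2
  rcases h1 : o x i with _ | _ <;> rcases h2 : o x (nextRung i) with _ | _ <;>
    simp only [h1, h2, reduceIte, Bool.false_eq_true] at m1 m2 ⊢
  · rcases hS (Sum.inl ⟨x, nextRung i, 1⟩) (Sum.inl ⟨x, i, 2⟩) (Sum.inl ⟨x, nextRung i, 3⟩)
      (Sum.inl ⟨x, nextRung (nextRung i), 2⟩) (Or.inr m1)
      (Or.inl (satC4ComplGraph_adj_step hocc i (by decide)))
      (Or.inl (satC4ComplGraph_adj_step hocc _ (by decide)))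
      (Or.inr (Sym2.eq_swap ▸ m2)) (by simp) (by simpa using hne)
      (satC4ComplGraph_not_adj_of_not_ladderAdj hocc 0 (by decide) hzero (by decide))
      (satC4ComplGraph_not_adj_of_not_ladderAdj hocc 2 (by decide) hd (by decide)) with h | h
    · exact (hlab (by decide) h).elim
    · exact (hlab (by decide) h).elim
  · rcases hS (Sum.inl ⟨x, i, 1⟩) (Sum.inl ⟨x, nextRung i, 0⟩)
      (Sum.inl ⟨x, nextRung (nextRung i), 1⟩) (Sum.inl ⟨x, nextRung i, 2⟩)
      (Or.inl (satC4ComplGraph_adj_step hocc i (by decide)))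
      (Or.inl (satC4ComplGraph_adj_step hocc _ (by decide)))
      (Or.inr m2) (Or.inr (Sym2.eq_swap ▸ m1)) (by simpa using hne) (by simp)
      (satC4ComplGraph_not_adj_of_not_ladderAdj hocc 2 (by decide) hd (by decide))
      (satC4ComplGraph_not_adj_of_not_ladderAdj hocc 0 (by decide) hzero (by decide)) with h | h
    · exact (hlab (by decide) h).elim
    · exact (hlab (by decide) h).elim

theorem orientation_eq (hocc : ∀ x : Var, 2 ≤ numOcc lit x)
    (hS : HitsDiagonals (satC4ComplGraph lit) (Set.range (addedEdge lit o σ))) (x : Var)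
    (i : Fin (4 * numOcc lit x)) : o x i = o x ⟨0, i.pos⟩ := by
  obtain ⟨k, hk⟩ := i
  induction k with
  | zero => rfl
  | succ k ih =>
    rw [← ih (by omega), ← orientation_nextRung hocc hS x ⟨k, by omega⟩]
    congr 1
    exact Fin.ext (Nat.mod_eq_of_lt hk).symm

theorem orientation_eq_literal (hocc : ∀ x : Var, 2 ≤ numOcc lit x)
    (hS : HitsDiagonals (satC4ComplGraph lit) (Set.range (addedEdge lit o σ))) (c : Fin m)
    (i : Fin (4 * numOcc lit (lit c (σ c)).1)) : o _ i = (lit c (σ c)).2 := by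
  have hlt := occIdx_lt_numOcc lit c (σ c)
  rw [orientation_eq hocc hS]
  set j : Fin (4 * numOcc lit (lit c (σ c)).1) :=
    ⟨4 * occIdx lit (lit c (σ c)).1 c, by omega⟩ with hj
  have hj' : (nextRung j : ℕ) = 4 * occIdx lit (lit c (σ c)).1 c + 1 :=
    Nat.mod_eq_of_lt (by simp only [hj]; omega)
  rw [← orientation_eq hocc hS _ j]
  have hv : addedEdge lit o σ (Sum.inr (c, 1)) ∈ Set.range (addedEdge lit o σ) := ⟨_, rfl⟩
  have hsq : addedEdge lit o σ (Sum.inl ⟨_, j⟩) ∈ Set.range (addedEdge lit o σ) := ⟨_, rfl⟩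
  simp only [addedEdge, one_ne_zero, if_false] at hv hsq
  have main : ∀ k l : Fin (4 * numOcc lit (lit c (σ c)).1),
      (k : ℕ) = 4 * occIdx lit (lit c (σ c)).1 c + ((lit c (σ c)).2).toNat →
      (l : ℕ) = 4 * occIdx lit (lit c (σ c)).1 c + (!(lit c (σ c)).2).toNat →
      s(Sum.inl ⟨_, k, 1⟩, Sum.inl ⟨_, l, 2⟩) ∉ Set.range (addedEdge lit o σ) := by
    intro k l hk hl hkl
    rcases hS (Sum.inl ⟨_, k, 1⟩) (Sum.inr (c, Sum.inl (clauseV (σ c))))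
      (Sum.inr (c, Sum.inl (clauseU (σ c)))) (Sum.inl ⟨_, l, 2⟩)
      (Or.inl ((satC4ComplGraph_adj_inl_core lit _ _ _ _ _).2
        ⟨σ c, rfl, Or.inl ⟨rfl, hk, rfl⟩⟩)) (Or.inr hv)
      (Or.inl ((satC4ComplGraph_adj_inl_core lit _ _ _ _ _).2
        ⟨σ c, rfl, Or.inr ⟨rfl, hl, rfl⟩⟩).symm)
      (Or.inr (Sym2.eq_swap ▸ hkl)) (by simp) (by simp)
      (fun h => not_crossAdj_one_clauseU _ ((satC4ComplGraph_adj_inl_core lit _ _ _ _ _).1 h))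
      (fun h => not_crossAdj_two_clauseV _
        ((satC4ComplGraph_adj_inl_core lit _ _ _ _ _).1 h.symm)) with h | h
    · exact inl_inr_notMem_range_addedEdge _ _ _ _ _ h
    · exact inl_inr_notMem_range_addedEdge _ _ _ _ _ (Sym2.eq_swap ▸ h)
  rcases h1 : o _ j with _ | _ <;> rcases h2 : (lit c (σ c)).2 with _ | _ <;>
    simp only [h1, reduceIte, Bool.false_eq_true] at hsq ⊢
  · exact main _ _ (by rw [h2]; exact hj') (by rw [h2]; rfl) hsq |>.elim
  · exact main _ _ (by rw [h2]; rfl) (by rw [h2]; exact hj') hsq |>.elim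

end Completion

/-- The 3-SAT formula `φ` (clauses with exactly three literals on pairwise distinct
variables, every variable occurring in at least two clauses) is satisfiable iff at most
`k_φ = 14|C(φ)|` non-edges can be added to `G_φ` so that no induced `C₄` remains. -/
theorem satC4ComplGraph_correct {m : ℕ} (lit : Fin m → Fin 3 → Var × Bool)
    (hdist : ∀ c, Function.Injective (fun a : Fin 3 => (lit c a).1))
    (hocc : ∀ x : Var, 2 ≤ numOcc lit x) :
    (∃ α : Var → Bool, ∀ c : Fin m, ∃ a : Fin 3, α (lit c a).1 = (lit c a).2) ↔
    (∃ S : Set (Sym2 ((Σ x : Var, Fin (4 * numOcc lit x) × Fin 4) ⊕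
        (Fin m × (Fin 8 ⊕ Fin (14 * m) × Fin 2)))),
      (∀ e ∈ S, ¬ e.IsDiag) ∧ Disjoint S (satC4ComplGraph lit).edgeSet ∧
      S.ncard ≤ 14 * m ∧
      IsEmpty (SimpleGraph.cycleGraph 4 ↪g
        (satC4ComplGraph lit ⊔ SimpleGraph.fromEdgeSet S))) := by
  have := finite_var lit hocc
  constructor
  · rintro ⟨α, hα⟩
    choose σ hσ using hα
    refine ⟨Set.range (addedEdge lit (fun x _ => α x) σ), ?_,
      disjoint_range_addedEdge lit α σ hocc, ?_,
      isEmpty_cycleGraph_four_embedding_completion lit α σ hocc hdist hσ⟩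
    · rintro _ ⟨k, rfl⟩
      exact addedEdge_not_isDiag lit _ σ k
    · rw [Set.ncard_range_of_injective (addedEdge_injective lit _ σ hocc),
        card_addedIndex lit hocc hdist]
  · rintro ⟨S, hdiag, -, hcard, hS⟩
    replace hS := hitsDiagonals_of_isEmpty hdiag hS
    obtain ⟨o, σ, rfl⟩ := exists_eq_range_addedEdge hocc hdist hS hcard
    exact ⟨fun x => o x ⟨0, by have := hocc x; omega⟩,
      fun c => ⟨σ c, orientation_eq_literal hocc hS c _⟩⟩
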